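/- Let A and B be associative unital k-algebras and let R: B⊗A → A⊗B and Q: A⊗B → A⊗B satisfy the L-R-twisted tensor product conditions. Then the linear maps J = R, T = Q, γ: A⊗A → A⊗A⊗B, γ(a⊗a') = a⊗a'⊗1_B, and η: A⊗A → A⊗B⊗B, η(a⊗a') = aa'⊗1_B⊗1_B, satisfy the L-R-crossed product axioms (1)-(13) (with U = A, 1_U = 1_A, and B playing the role of H). -/

import Mathlib

open TensorProduct LinearMap

noncomputable section

variable {k : Type*} [Field k]

section Helpers

variable {M N P Q : Type*}
  [AddCommMonoid M] [AddCommMonoid N] [AddCommMonoid P] [AddCommMonoid Q]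
  [Module k M] [Module k N] [Module k P] [Module k Q]

def aso : (M ⊗[k] N) ⊗[k] P →ₗ[k] M ⊗[k] (N ⊗[k] P) :=
  (TensorProduct.assoc k M N P).toLinearMap

def osa : M ⊗[k] (N ⊗[k] P) →ₗ[k] (M ⊗[k] N) ⊗[k] P :=
  (TensorProduct.assoc k M N P).symm.toLinearMap

def cc : M ⊗[k] N →ₗ[k] N ⊗[k] M := (TensorProduct.comm k M N).toLinearMap

def lc : M ⊗[k] (N ⊗[k] P) →ₗ[k] N ⊗[k] (M ⊗[k] P) :=
  (TensorProduct.leftComm k M N P).toLinearMap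

def tt : (M ⊗[k] N) ⊗[k] (P ⊗[k] Q) →ₗ[k] (M ⊗[k] P) ⊗[k] (N ⊗[k] Q) :=
  (TensorProduct.tensorTensorTensorComm k M N P Q).toLinearMap

end Helpers

section LRCrossed

variable (k)
variable (H U : Type*) [Ring H] [Algebra k H] [AddCommGroup U] [Module k U]

abbrev mH : H ⊗[k] H →ₗ[k] H := LinearMap.mul' k H

def dR : (H ⊗[k] H) ⊗[k] H →ₗ[k] H ⊗[k] H :=
  rTensor H (mH k H) ∘ₗ osa ∘ₗ lTensor H cc ∘ₗ aso

/-- `d ⊗ (g ⊗ i) ↦ (d*g) ⊗ i`. -/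
def dL : H ⊗[k] (H ⊗[k] H) →ₗ[k] H ⊗[k] H :=
  rTensor H (mH k H) ∘ₗ osa

/-- `(g ⊗ i) ⊗ d ↦ g ⊗ (d*i)`. -/
def eR : (H ⊗[k] H) ⊗[k] H →ₗ[k] H ⊗[k] H :=
  lTensor H ((mH k H) ∘ₗ cc) ∘ₗ aso

/-- `d ⊗ (g ⊗ i) ↦ g ⊗ (i*d)`. -/
def eL : H ⊗[k] (H ⊗[k] H) →ₗ[k] H ⊗[k] H :=
  lTensor H ((mH k H) ∘ₗ cc) ∘ₗ lc

/-- `(g ⊗ i) ⊗ (a ⊗ b) ↦ (g*a) ⊗ (b*i)`. -/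
def mulLR : (H ⊗[k] H) ⊗[k] (H ⊗[k] H) →ₗ[k] H ⊗[k] H :=
  TensorProduct.map (mH k H) ((mH k H) ∘ₗ cc) ∘ₗ tt


def w12 : H ⊗[k] (H ⊗[k] H) →ₗ[k] H ⊗[k] H :=
  lTensor H ((mH k H) ∘ₗ cc) ∘ₗ lc ∘ₗ lTensor H cc

def inner12 : (H ⊗[k] H) ⊗[k] (H ⊗[k] H) →ₗ[k] H ⊗[k] H :=
  lTensor H ((mH k H) ∘ₗ cc) ∘ₗ aso ∘ₗ lTensor (H ⊗[k] H) ((mH k H) ∘ₗ cc)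

/-- `(g ⊗ i) ⊗ (b ⊗ (d ⊗ e)) ↦ g * d * e * b * i`. -/
def omegaM : (H ⊗[k] H) ⊗[k] (H ⊗[k] (H ⊗[k] H)) →ₗ[k] H :=
  (mH k H) ∘ₗ
    TensorProduct.map (mH k H) ((mH k H) ∘ₗ rTensor H (mH k H) ∘ₗ cc) ∘ₗ
    tt ∘ₗ lTensor (H ⊗[k] H) (lTensor H cc ∘ₗ lc)

variable {H U}
variable (J : H ⊗[k] U →ₗ[k] U ⊗[k] H) (T : U ⊗[k] H →ₗ[k] U ⊗[k] H)
variable (γ : U ⊗[k] U →ₗ[k] U ⊗[k] (U ⊗[k] H))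
variable (η : U ⊗[k] U →ₗ[k] U ⊗[k] (H ⊗[k] H))

variable (oneU : U)

/-- Axiom (1): `J(h ⊗ 1_U) = 1_U ⊗ h` and `J(1_H ⊗ u) = u ⊗ 1_H`. -/
def LRax1 : Prop :=
  (∀ h : H, J (h ⊗ₜ oneU) = oneU ⊗ₜ h) ∧ (∀ u : U, J ((1 : H) ⊗ₜ u) = u ⊗ₜ (1 : H))

/-- Axiom (2): `T(u ⊗ 1_H) = u ⊗ 1_H` and `T(1_U ⊗ h) = 1_U ⊗ h`. -/
def LRax2 : Prop :=
  (∀ u : U, T (u ⊗ₜ (1 : H)) = u ⊗ₜ (1 : H)) ∧ (∀ h : H, T (oneU ⊗ₜ h) = oneU ⊗ₜ h)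

/-- Axiom (3): `γ(u ⊗ 1_U) = u ⊗ 1_U ⊗ 1_H` and `γ(1_U ⊗ u) = 1_U ⊗ u ⊗ 1_H`. -/
def LRax3 : Prop :=
  (∀ u : U, γ (u ⊗ₜ oneU) = u ⊗ₜ (oneU ⊗ₜ (1 : H))) ∧
  (∀ u : U, γ (oneU ⊗ₜ u) = oneU ⊗ₜ (u ⊗ₜ (1 : H)))

/-- Axiom (4): `η(u ⊗ 1_U) = η(1_U ⊗ u) = u ⊗ 1_H ⊗ 1_H`. -/
def LRax4 : Prop :=
  (∀ u : U, η (u ⊗ₜ oneU) = u ⊗ₜ ((1 : H) ⊗ₜ (1 : H))) ∧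
  (∀ u : U, η (oneU ⊗ₜ u) = u ⊗ₜ ((1 : H) ⊗ₜ (1 : H)))

/-- Axiom (5): `u_J ⊗ (hh')_J = (u_J)_j ⊗ h_j h'_J`. -/
def LRax5 : Prop := ∀ (h h' : H) (u : U),
  J ((h * h') ⊗ₜ u) =
    lTensor U (mH k H) (aso (rTensor H J (osa (h ⊗ₜ (J (h' ⊗ₜ u))))))

/-- Axiom (6): `u_T ⊗ (hh')_T = (u_T)_t ⊗ h_T h'_t`. -/
def LRax6 : Prop := ∀ (u : U) (h h' : H),
  T (u ⊗ₜ (h * h')) =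
    lTensor U ((mH k H) ∘ₗ cc)
      (aso (rTensor H T (osa (lTensor U cc (aso ((T (u ⊗ₜ h)) ⊗ₜ h'))))))

/-- Axiom (7):
`η₁(u_J,u'_j) ⊗ η₂(u_J,u'_j)(h_J)_j ⊗ η₃(u_J,u'_j) = η₁(u,u')_J ⊗ h_J η₂(u,u') ⊗ η₃(u,u')`. -/
def LRax7 : Prop := ∀ (h : H) (u u' : U),
  lTensor U (dR k H)
      (aso (rTensor H η (osa (lTensor U J (aso ((J (h ⊗ₜ u)) ⊗ₜ u'))))))
  = lTensor U (dL k H)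
      (aso (rTensor (H ⊗[k] H) J (osa (h ⊗ₜ (η (u ⊗ₜ u'))))))

/-- Axiom (8):
`η₁(u_t,u'_T) ⊗ η₂(u_t,u'_T) ⊗ (h_T)_t η₃(u_t,u'_T) = η₁(u,u')_T ⊗ η₂(u,u') ⊗ η₃(u,u')h_T`. -/
def LRax8 : Prop := ∀ (u u' : U) (h : H),
  lTensor U (eR k H)
      (aso (rTensor H η (osa (lTensor U cc
        (aso (rTensor U T (osa (lTensor U cc (u ⊗ₜ (T (u' ⊗ₜ h)))))))))))
  = lTensor U (eL k H)
      (aso (rTensor (H ⊗[k] H) T (osa (lTensor U cc (aso ((η (u ⊗ₜ u')) ⊗ₜ h))))))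

/-- Axiom (9). -/
def LRax9 : Prop := ∀ (u u' u'' : U),
  lTensor U (mulLR k H)
      (aso (rTensor (H ⊗[k] H) η (osa (lTensor U (aso (P := H))
        ((lTensor U (rTensor H J ∘ₗ osa ∘ₗ lTensor H cc ∘ₗ aso))
          (aso ((η (u ⊗ₜ u')) ⊗ₜ u'')))))))
  = lTensor U ((mulLR k H) ∘ₗ lTensor (H ⊗[k] H) cc)
      (aso (rTensor (H ⊗[k] H) η (tt (rTensor (U ⊗[k] H) T
        (osa (lTensor U (lc ∘ₗ lTensor U cc) (u ⊗ₜ (η (u' ⊗ₜ u'')))))))))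


def qJ : (U ⊗[k] H) ⊗[k] H →ₗ[k] U ⊗[k] H :=
  lTensor U (mH k H) ∘ₗ aso ∘ₗ rTensor H J ∘ₗ osa ∘ₗ lc ∘ₗ lTensor U cc ∘ₗ aso

/-- Axiom (10). -/
def LRax10 : Prop := ∀ (u u' : U) (h : H),
  lTensor U (lTensor U ((mH k H) ∘ₗ cc))
      (aso (tt (rTensor (U ⊗[k] H) T (osa (lTensor U cc
        (aso (rTensor H γ (osa (u ⊗ₜ (J (h ⊗ₜ u')))))))))))
  = lTensor U (qJ k J)
      (aso (rTensor H γ (osa (lTensor U cc (aso ((T (u ⊗ₜ h)) ⊗ₜ u'))))))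

def psi11 : (U ⊗[k] H) ⊗[k] (H ⊗[k] H) →ₗ[k] U ⊗[k] (H ⊗[k] H) :=
  lTensor U (rTensor H (mH k H) ∘ₗ osa) ∘ₗ aso

def chainX : (U ⊗[k] H) ⊗[k] (U ⊗[k] H) →ₗ[k] U ⊗[k] (H ⊗[k] H) :=
  (lTensor U ((dR k H) ∘ₗ lTensor (H ⊗[k] H) (mH k H))) ∘ₗ aso ∘ₗ
    rTensor (H ⊗[k] H) η ∘ₗ rTensor (H ⊗[k] H) cc ∘ₗ tt ∘ₗ
    lTensor (U ⊗[k] H) cc ∘ₗ rTensor (H ⊗[k] U) J ∘ₗ rTensor (H ⊗[k] U) cc ∘ₗ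
    tt ∘ₗ lTensor (U ⊗[k] H) cc

/-- Axiom (11). -/
def LRax11 : Prop := ∀ (u u' u'' : U),
  lTensor U (psi11 k)
      (aso (tt (rTensor ((U ⊗[k] H) ⊗[k] H) T (tt (rTensor (H ⊗[k] H) γ
        (osa (u ⊗ₜ (η (u' ⊗ₜ u'')))))))))
  = lTensor U (chainX k J η)
      (aso (rTensor (U ⊗[k] H) γ (osa (lTensor U cc
        (aso ((γ (u ⊗ₜ u')) ⊗ₜ u''))))))

def chain12 : (U ⊗[k] H) ⊗[k] (H ⊗[k] H) →ₗ[k] U ⊗[k] (H ⊗[k] H) :=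
  (lTensor U (w12 k H)) ∘ₗ aso ∘ₗ tt ∘ₗ rTensor (H ⊗[k] H) J ∘ₗ
    rTensor (H ⊗[k] H) cc ∘ₗ tt ∘ₗ lTensor (U ⊗[k] H) cc

def big12 : (H ⊗[k] H) ⊗[k] (H ⊗[k] (U ⊗[k] H)) →ₗ[k] U ⊗[k] (H ⊗[k] H) :=
  lTensor U (inner12 k H) ∘ₗ lc ∘ₗ lTensor (H ⊗[k] H) lc

/-- Axiom (12). -/
def LRax12 : Prop := ∀ (u u' u'' : U),
  lTensor U (chain12 k J)
      (aso (rTensor (H ⊗[k] H) γ (osa (lTensor U cc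
        (aso ((η (u ⊗ₜ u')) ⊗ₜ u''))))))
  = lTensor U (big12 k)
      (aso (rTensor (H ⊗[k] (U ⊗[k] H)) η (tt (lTensor (U ⊗[k] H) cc
        (rTensor ((U ⊗[k] H) ⊗[k] U) T (tt (lTensor (U ⊗[k] (U ⊗[k] H)) cc
          (rTensor (U ⊗[k] H) γ (osa (lTensor U lc (u ⊗ₜ (γ (u' ⊗ₜ u'')))))))))))))

def w13 : H ⊗[k] (U ⊗[k] H) →ₗ[k] U ⊗[k] H :=
  lTensor U ((mH k H) ∘ₗ cc) ∘ₗ lc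

def xi2 : H ⊗[k] (U ⊗[k] H) →ₗ[k] U ⊗[k] H :=
  lTensor U (mH k H) ∘ₗ aso ∘ₗ rTensor H J ∘ₗ osa

def xi : H ⊗[k] (U ⊗[k] (U ⊗[k] H)) →ₗ[k] U ⊗[k] (U ⊗[k] H) :=
  lTensor U (xi2 k J) ∘ₗ lc

def rho : (U ⊗[k] H) ⊗[k] U →ₗ[k] (U ⊗[k] (U ⊗[k] H)) ⊗[k] H :=
  rTensor H γ ∘ₗ osa ∘ₗ lTensor U cc ∘ₗ aso

def chainR : ((U ⊗[k] (U ⊗[k] H)) ⊗[k] H) ⊗[k] H →ₗ[k] (U ⊗[k] H) ⊗[k] (U ⊗[k] H) :=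
  tt ∘ₗ lTensor (U ⊗[k] U) cc ∘ₗ
    lTensor (U ⊗[k] U) (rTensor H ((mH k H) ∘ₗ cc) ∘ₗ osa) ∘ₗ tt ∘ₗ
    lTensor (U ⊗[k] H) aso ∘ₗ rTensor ((U ⊗[k] H) ⊗[k] H) T ∘ₗ tt ∘ₗ
    lTensor (U ⊗[k] (U ⊗[k] H)) cc ∘ₗ aso

/-- The composite computing the right-hand side of axiom (13). -/
def rhs13 : ((H ⊗[k] (U ⊗[k] U)) ⊗[k] U) ⊗[k] H →ₗ[k]
    (U ⊗[k] (U ⊗[k] H)) ⊗[k] (U ⊗[k] H) :=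
  osa ∘ₗ lTensor U (chainR k T) ∘ₗ aso ∘ₗ
    rTensor H (lTensor U (rho k γ) ∘ₗ aso ∘ₗ rTensor U ((xi k J) ∘ₗ lTensor H γ))

/-- Axiom (13). -/
def LRax13 : Prop := ∀ (u u' u'' : U) (h h' : H),
  rTensor (U ⊗[k] H) (xi k J)
      (osa (h' ⊗ₜ (lTensor (U ⊗[k] (U ⊗[k] H)) (w13 k)
        (aso (rTensor (U ⊗[k] H) (rTensor H γ) (rTensor (U ⊗[k] H) osa
          (osa (u ⊗ₜ (rTensor (U ⊗[k] H) T (osa (lTensor U cc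
            (aso ((γ (u' ⊗ₜ u'')) ⊗ₜ h)))))))))))))
  = rhs13 k J T γ (((h' ⊗ₜ (u ⊗ₜ u')) ⊗ₜ u'') ⊗ₜ h)

/-- The L-R-crossed product multiplication, as a linear map. -/
def lrM : (U ⊗[k] H) ⊗[k] (U ⊗[k] H) →ₗ[k] U ⊗[k] H :=
  lTensor U (omegaM k H) ∘ₗ aso ∘ₗ rTensor (H ⊗[k] (H ⊗[k] H)) η ∘ₗ tt ∘ₗ
    lTensor (U ⊗[k] H) aso ∘ₗ rTensor ((U ⊗[k] H) ⊗[k] H) T ∘ₗ tt ∘ₗ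
    lTensor (U ⊗[k] (U ⊗[k] H)) cc ∘ₗ
    rTensor (H ⊗[k] H) (lTensor U J ∘ₗ lTensor U cc ∘ₗ aso) ∘ₗ tt ∘ₗ
    rTensor (H ⊗[k] H) (osa ∘ₗ γ) ∘ₗ tt

/-- The L-R-crossed product multiplication of two elements of `U ⊗ H`. -/
def lrMul (x y : U ⊗[k] H) : U ⊗[k] H := lrM k J T γ η (x ⊗ₜ y)

end LRCrossed


section TTP

variable {k : Type*} [Field k]
variable {A B : Type*} [Ring A] [Algebra k A] [Ring B] [Algebra k B]
variable (R : B ⊗[k] A →ₗ[k] A ⊗[k] B) (Q : A ⊗[k] B →ₗ[k] A ⊗[k] B)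

/-- The conditions defining an L-R-twisted tensor product `A ⊗_{Q,R} B`. -/
structure IsLRTwistedTensorProduct : Prop where
  R_one : ∀ b : B, R (b ⊗ₜ (1 : A)) = (1 : A) ⊗ₜ b
  one_R : ∀ a : A, R ((1 : B) ⊗ₜ a) = a ⊗ₜ (1 : B)
  Q_one : ∀ a : A, Q (a ⊗ₜ (1 : B)) = a ⊗ₜ (1 : B)
  one_Q : ∀ b : B, Q ((1 : A) ⊗ₜ b) = (1 : A) ⊗ₜ b
  mul_R : ∀ (a a' : A) (b : B),
    R (b ⊗ₜ (a * a')) =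
      rTensor B (LinearMap.mul' k A) (osa (lTensor A R (aso ((R (b ⊗ₜ a)) ⊗ₜ a'))))
  R_mul : ∀ (a : A) (b b' : B),
    R ((b * b') ⊗ₜ a) =
      lTensor A (LinearMap.mul' k B) (aso (rTensor B R (osa (b ⊗ₜ (R (b' ⊗ₜ a))))))
  mul_Q : ∀ (a a' : A) (b : B),
    Q ((a * a') ⊗ₜ b) =
      rTensor B (LinearMap.mul' k A) (osa (lTensor A cc (aso (rTensor A Q
        (osa (lTensor A cc (a ⊗ₜ (Q (a' ⊗ₜ b)))))))))
  Q_mul : ∀ (a : A) (b b' : B),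
    Q (a ⊗ₜ (b * b')) =
      lTensor A ((LinearMap.mul' k B) ∘ₗ cc) (aso (rTensor B Q
        (osa (lTensor A cc (aso ((Q (a ⊗ₜ b)) ⊗ₜ b'))))))
  QR_comm : ∀ (a a' : A) (b : B),
    lTensor A cc (aso (rTensor A Q (osa (lTensor A cc (a ⊗ₜ (R (b ⊗ₜ a'))))))) =
      lTensor A R (aso ((Q (a ⊗ₜ b)) ⊗ₜ a'))
  RQ_comm : ∀ (a' : A) (b b' : B),
    aso (rTensor B R (osa (b' ⊗ₜ (Q (a' ⊗ₜ b))))) =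
      lTensor A cc (aso (rTensor B Q (osa (lTensor A cc (aso ((R (b' ⊗ₜ a')) ⊗ₜ b))))))

end TTP


section EvaluationLemmas

variable {M N P S : Type*}
  [AddCommMonoid M] [AddCommMonoid N] [AddCommMonoid P] [AddCommMonoid S]
  [Module k M] [Module k N] [Module k P] [Module k S]

@[simp]
theorem aso_tmul (m : M) (n : N) (p : P) :
    aso (k := k) ((m ⊗ₜ n) ⊗ₜ p) = m ⊗ₜ (n ⊗ₜ p) := rfl

@[simp]
theorem osa_tmul (m : M) (n : N) (p : P) :
    osa (k := k) (m ⊗ₜ (n ⊗ₜ p)) = (m ⊗ₜ n) ⊗ₜ p := rfl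

@[simp]
theorem cc_tmul (m : M) (n : N) : cc (k := k) (m ⊗ₜ n) = n ⊗ₜ m := rfl

@[simp]
theorem lc_tmul (m : M) (n : N) (p : P) :
    lc (k := k) (m ⊗ₜ (n ⊗ₜ p)) = n ⊗ₜ (m ⊗ₜ p) := rfl

@[simp]
theorem tt_tmul (m : M) (n : N) (p : P) (s : S) :
    tt (k := k) ((m ⊗ₜ n) ⊗ₜ (p ⊗ₜ s)) = (m ⊗ₜ p) ⊗ₜ (n ⊗ₜ s) := rfl

end EvaluationLemmas

section CrossedProductAxioms

variable {A B : Type*} [Ring A] [Algebra k A] [Ring B] [Algebra k B]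

/-- The map `a ⊗ a' ↦ a ⊗ a' ⊗ 1`. -/
local notation "γ₀" => lTensor A (LinearMap.flip (TensorProduct.mk k A B) (1 : B))

/-- The map `a ⊗ a' ↦ a a' ⊗ 1 ⊗ 1`. -/
local notation "η₀" =>
  LinearMap.flip (TensorProduct.mk k A (B ⊗[k] B)) ((1 : B) ⊗ₜ (1 : B)) ∘ₗ LinearMap.mul' k A

variable {R : B ⊗[k] A →ₗ[k] A ⊗[k] B} {Q : A ⊗[k] B →ₗ[k] A ⊗[k] B}

namespace IsLRTwistedTensorProduct

theorem lrAx7 (hQR : IsLRTwistedTensorProduct R Q) : LRax7 k R η₀ := by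
  intro h u u'
  have hl : ∀ x : (A ⊗[k] A) ⊗[k] B, lTensor A (dR k B) (aso (rTensor B η₀ x)) =
      lTensor A ((TensorProduct.mk k B B).flip 1) (rTensor B (LinearMap.mul' k A) x) := by
    refine LinearMap.congr_fun (f := lTensor A (dR k B) ∘ₗ aso ∘ₗ rTensor B η₀)
      (g := lTensor A ((TensorProduct.mk k B B).flip 1) ∘ₗ rTensor B (LinearMap.mul' k A)) ?_
    ext a a' b
    simp [dR]
  have hr : ∀ x : A ⊗[k] B, lTensor A (dL k B) (aso (x ⊗ₜ ((1 : B) ⊗ₜ (1 : B)))) =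
      lTensor A ((TensorProduct.mk k B B).flip 1) x := by
    intro x
    induction x with
    | zero => simp
    | tmul a b => simp [dL]
    | add x y hx hy => simp only [add_tmul, map_add, hx, hy]
  rw [hl, ← hQR.mul_R]
  simp [hr]

theorem lrAx8 (hQR : IsLRTwistedTensorProduct R Q) : LRax8 k Q η₀ := by
  intro u u' h
  have hl : ∀ x : A ⊗[k] (B ⊗[k] A),
      lTensor A (eR k B) (aso (rTensor B η₀ (osa (lTensor A cc x)))) =
      lTensor A (TensorProduct.mk k B B 1)
        (rTensor B (LinearMap.mul' k A) (osa (lTensor A cc x))) := by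
    refine LinearMap.congr_fun
      (f := lTensor A (eR k B) ∘ₗ aso ∘ₗ rTensor B η₀ ∘ₗ osa ∘ₗ lTensor A cc)
      (g := lTensor A (TensorProduct.mk k B B 1) ∘ₗ rTensor B (LinearMap.mul' k A) ∘ₗ
        osa ∘ₗ lTensor A cc) ?_
    ext a b a'
    simp [eR]
  have hr : ∀ x : A ⊗[k] B, lTensor A (eL k B) (aso (x ⊗ₜ ((1 : B) ⊗ₜ (1 : B)))) =
      lTensor A (TensorProduct.mk k B B 1) x := by
    intro x
    induction x with
    | zero => simp
    | tmul a b => simp [eL]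
    | add x y hx hy => simp only [add_tmul, map_add, hx, hy]
  rw [hl, ← hQR.mul_Q]
  simp [hr]

theorem lrAx9 (hQR : IsLRTwistedTensorProduct R Q) : LRax9 k R Q η₀ := by
  intro u u' u''
  simp [mulLR, hQR.one_R, hQR.Q_one, mul_assoc]

theorem lrAx10 (hQR : IsLRTwistedTensorProduct R Q) : LRax10 k R Q γ₀ := by
  intro u u' h
  have hl : ∀ x : A ⊗[k] B,
      lTensor A (lTensor A ((mH k B) ∘ₗ cc)) (aso (tt (rTensor (A ⊗[k] B) Q (osa (lTensor A cc
        (aso (rTensor B γ₀ (osa (u ⊗ₜ x))))))))) =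
      lTensor A cc (aso (rTensor A Q (osa (lTensor A cc (u ⊗ₜ x))))) := by
    intro x
    induction x with
    | zero => simp
    | add x y hx hy => simp only [tmul_add, map_add, hx, hy]
    | tmul a b =>
      simp only [osa_tmul, rTensor_tmul, lTensor_tmul, flip_apply, mk_apply, aso_tmul, cc_tmul]
      induction Q (u ⊗ₜ b) with
      | zero => simp
      | tmul c d => simp
      | add x y hx hy => simp only [add_tmul, map_add, hx, hy]
  have hr : ∀ x : A ⊗[k] B,
      lTensor A (qJ k R) (aso (rTensor B γ₀ (osa (lTensor A cc (aso (x ⊗ₜ u')))))) =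
      lTensor A R (aso (x ⊗ₜ u')) := by
    intro x
    induction x with
    | zero => simp
    | add x y hx hy => simp only [add_tmul, map_add, hx, hy]
    | tmul a b =>
      simp only [qJ, coe_comp, Function.comp_apply, osa_tmul, rTensor_tmul, lTensor_tmul,
        flip_apply, mk_apply, aso_tmul, cc_tmul, lc_tmul]
      congr 1
      induction R (b ⊗ₜ u') with
      | zero => simp
      | tmul c d => simp
      | add x y hx hy => simp only [add_tmul, map_add, hx, hy]
  rw [hl, hr, hQR.QR_comm]

theorem lrAx11 (hQR : IsLRTwistedTensorProduct R Q) : LRax11 k R Q γ₀ η₀ := by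
  intro u u' u''
  simp [psi11, chainX, dR, hQR.one_R, hQR.Q_one]

theorem lrAx12 (hQR : IsLRTwistedTensorProduct R Q) : LRax12 k R Q γ₀ η₀ := by
  intro u u' u''
  simp [chain12, big12, w12, inner12, hQR.one_R, hQR.Q_one]

theorem lrAx13 (hQR : IsLRTwistedTensorProduct R Q) : LRax13 k R Q γ₀ := by
  intro u u' u'' h h'
  let G : A ⊗[k] (B ⊗[k] B) →ₗ[k] (A ⊗[k] (A ⊗[k] B)) ⊗[k] (A ⊗[k] B) :=
    TensorProduct.map (TensorProduct.mk k A (A ⊗[k] B) u) (TensorProduct.mk k A B u'') ∘ₗ osa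
  have hone : ∀ y : A ⊗[k] B, lTensor A (mH k B) (aso (y ⊗ₜ (1 : B))) = y := by
    intro y
    induction y with
    | zero => simp
    | tmul a b => simp
    | add x y hx hy => simp only [add_tmul, map_add, hx, hy]
  have hl : ∀ x : A ⊗[k] B,
      rTensor (A ⊗[k] B) (xi k R) (osa (h' ⊗ₜ (lTensor (A ⊗[k] (A ⊗[k] B)) (w13 k)
        (aso (rTensor B γ₀ (osa (u ⊗ₜ x)) ⊗ₜ (u'' ⊗ₜ (1 : B))))))) =
      G (aso (rTensor B R (osa (h' ⊗ₜ x)))) := by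
    intro x
    induction x with
    | zero => simp
    | add x y hx hy => simp only [add_tmul, tmul_add, map_add, hx, hy]
    | tmul a b =>
      simp only [xi, xi2, w13, coe_comp, Function.comp_apply, osa_tmul, rTensor_tmul,
        lTensor_tmul, flip_apply, mk_apply, aso_tmul, cc_tmul, lc_tmul, mul'_apply, one_mul, hone]
      induction R (h' ⊗ₜ a) with
      | zero => simp
      | tmul c d => simp [G]
      | add x y hx hy => simp only [add_tmul, tmul_add, map_add, hx, hy]
  have hr : ∀ y : A ⊗[k] B,
      osa (u ⊗ₜ chainR k Q (rho k γ₀ (y ⊗ₜ u'') ⊗ₜ h)) =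
      G (lTensor A cc (aso (rTensor B Q (osa (lTensor A cc (aso (y ⊗ₜ h))))))) := by
    intro y
    induction y with
    | zero => simp
    | add x y hx hy => simp only [add_tmul, tmul_add, map_add, hx, hy]
    | tmul a b =>
      simp only [chainR, rho, coe_comp, Function.comp_apply, osa_tmul, rTensor_tmul,
        lTensor_tmul, flip_apply, mk_apply, aso_tmul, cc_tmul, tt_tmul]
      induction Q (a ⊗ₜ h) with
      | zero => simp
      | tmul c d => simp [G]
      | add x y hx hy => simp only [add_tmul, tmul_add, map_add, hx, hy]
  have hxi : xi k R (h' ⊗ₜ (u ⊗ₜ (u' ⊗ₜ (1 : B)))) = u ⊗ₜ R (h' ⊗ₜ u') := by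
    simp [xi, xi2, hone]
  simp only [rhs13, coe_comp, Function.comp_apply, lTensor_tmul, rTensor_tmul, flip_apply,
    mk_apply, aso_tmul, osa_tmul, cc_tmul, hxi, hl, hr]
  rw [hQR.RQ_comm]

end IsLRTwistedTensorProduct

end CrossedProductAxioms

/-- If `R`, `Q` satisfy the L-R-twisted tensor product conditions, then
`J := R`, `T := Q`, `γ(a⊗a') := a⊗a'⊗1_B`, `η(a⊗a') := aa'⊗1_B⊗1_B` satisfy the
L-R-crossed product axioms (1)-(13), with `U = A`, `1_U = 1_A` and `B` in the role of `H`. -/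
theorem ttp_gives_lr_crossed_product
    {k : Type*} [Field k] {A B : Type*} [Ring A] [Algebra k A] [Ring B] [Algebra k B]
    (R : B ⊗[k] A →ₗ[k] A ⊗[k] B) (Q : A ⊗[k] B →ₗ[k] A ⊗[k] B)
    (hQR : IsLRTwistedTensorProduct R Q) :
    LRax1 k R (1 : A) ∧ LRax2 k Q (1 : A) ∧
    LRax3 k (lTensor A ((TensorProduct.mk k A B).flip (1 : B))) (1 : A) ∧
    LRax4 k (((TensorProduct.mk k A (B ⊗[k] B)).flip ((1 : B) ⊗ₜ (1 : B))) ∘ₗ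
      LinearMap.mul' k A) (1 : A) ∧
    LRax5 k R ∧ LRax6 k Q ∧
    LRax7 k R (((TensorProduct.mk k A (B ⊗[k] B)).flip ((1 : B) ⊗ₜ (1 : B))) ∘ₗ
      LinearMap.mul' k A) ∧
    LRax8 k Q (((TensorProduct.mk k A (B ⊗[k] B)).flip ((1 : B) ⊗ₜ (1 : B))) ∘ₗ
      LinearMap.mul' k A) ∧
    LRax9 k R Q (((TensorProduct.mk k A (B ⊗[k] B)).flip ((1 : B) ⊗ₜ (1 : B))) ∘ₗ
      LinearMap.mul' k A) ∧
    LRax10 k R Q (lTensor A ((TensorProduct.mk k A B).flip (1 : B))) ∧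
    LRax11 k R Q (lTensor A ((TensorProduct.mk k A B).flip (1 : B)))
      (((TensorProduct.mk k A (B ⊗[k] B)).flip ((1 : B) ⊗ₜ (1 : B))) ∘ₗ
        LinearMap.mul' k A) ∧
    LRax12 k R Q (lTensor A ((TensorProduct.mk k A B).flip (1 : B)))
      (((TensorProduct.mk k A (B ⊗[k] B)).flip ((1 : B) ⊗ₜ (1 : B))) ∘ₗ
        LinearMap.mul' k A) ∧
    LRax13 k R Q (lTensor A ((TensorProduct.mk k A B).flip (1 : B))) := by
  refine ⟨⟨hQR.R_one, hQR.one_R⟩, ⟨hQR.Q_one, hQR.one_Q⟩, ⟨fun _ => rfl, fun _ => rfl⟩,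
    ⟨fun u => by simp, fun u => by simp⟩, fun h h' u => hQR.R_mul u h h', hQR.Q_mul,
    hQR.lrAx7, hQR.lrAx8, hQR.lrAx9, hQR.lrAx10, hQR.lrAx11, hQR.lrAx12, hQR.lrAx13⟩
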